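/- For integers k ≥ 2 and d ≥ 2^k + 1, there exists a constant a_k > 0 depending only on k such that the singular series satisfies 𝔖(N) ≥ a_k^d for all N ∈ ℕ; in particular 𝔖(N) > 0. -/

import Mathlib

noncomputable def e (x : ℝ) : ℂ := Complex.exp (2 * Real.pi * Complex.I * x)

noncomputable def warGauss (k q a : ℕ) : ℂ :=
  (q : ℂ)⁻¹ * ∑ r ∈ Finset.Icc 1 q, e ((a : ℝ) * (r : ℝ) ^ k / (q : ℝ))

/-- The singular series `𝔖(N)` (the `q = 0` term of the `tsum` vanishes since the
index set of the inner sum is then empty). -/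
noncomputable def singularSeries (k d N : ℕ) : ℂ :=
  ∑' q : ℕ, ∑ a ∈ (Finset.Icc 1 q).filter (fun a => Nat.Coprime a q),
    (warGauss k q a) ^ d * e (-((N : ℝ) * a / q))

open Finset

lemma norm_e (x : ℝ) : ‖e x‖ = 1 := by
  rw [e, show 2 * (Real.pi : ℂ) * Complex.I * x = ((2 * Real.pi * x : ℝ) : ℂ) * Complex.I by
    push_cast; ring]
  exact Complex.norm_exp_ofReal_mul_I _

lemma e_intCast_div (q : ℕ) [NeZero q] (j : ℤ) :
    e ((j : ℝ) / q) = ZMod.stdAddChar (j : ZMod q) := by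
  rw [ZMod.stdAddChar_coe, e]
  push_cast
  ring_nf

lemma e_natCast_div (q : ℕ) [NeZero q] (j : ℕ) :
    e ((j : ℝ) / q) = ZMod.stdAddChar (j : ZMod q) := by
  simpa using e_intCast_div q j

lemma sum_range_natCast_zmod {M : Type*} [AddCommMonoid M] (q : ℕ) [NeZero q] (f : ZMod q → M) :
    ∑ r ∈ range q, f r = ∑ x : ZMod q, f x := by
  refine sum_nbij' (fun r => (r : ZMod q)) ZMod.val ?_ ?_ ?_ ?_ ?_
  · simp
  · intro x _
    simpa using ZMod.val_lt x
  · intro r hr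
    exact ZMod.val_cast_of_lt (by simpa using hr)
  · simp
  · simp

lemma sum_Icc_natCast_zmod {M : Type*} [AddCommMonoid M] (q : ℕ) [NeZero q] (f : ZMod q → M) :
    ∑ r ∈ Icc 1 q, f r = ∑ x : ZMod q, f x := by
  rw [← sum_range_natCast_zmod, ← Finset.Ico_add_one_right_eq_Icc,
    sum_Ico_succ_top (NeZero.one_le), range_eq_Ico, sum_eq_sum_Ico_succ_bot (NeZero.pos q)]
  simp [add_comm]

lemma warGauss_eq_sum_zmod (k q a : ℕ) [NeZero q] :
    warGauss k q a = (q : ℂ)⁻¹ * ∑ x : ZMod q, ZMod.stdAddChar ((a : ZMod q) * x ^ k) := by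
  rw [warGauss, ← sum_Icc_natCast_zmod]
  congr 1
  refine sum_congr rfl fun r _ => ?_
  have h := e_natCast_div q (a * r ^ k)
  push_cast at h
  exact h

lemma norm_warGauss_le_one (k q a : ℕ) : ‖warGauss k q a‖ ≤ 1 := by
  rw [warGauss, norm_mul, norm_inv, Complex.norm_natCast]
  rcases Nat.eq_zero_or_pos q with rfl | hq
  · simp
  rw [inv_mul_le_iff₀ (by positivity)]
  refine (norm_sum_le _ _).trans ?_
  simp [norm_e]

lemma sum_range_mul_of_periodic (f : ℕ → ℂ) (c r : ℕ) (hf : ∀ x, f (x + r) = f x) :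
    ∑ x ∈ range (c * r), f x = c * ∑ x ∈ range r, f x := by
  have hper : ∀ m x, f (m * r + x) = f x := by
    intro m
    induction m with
    | zero => simp
    | succ m ih =>
      intro x
      rw [← ih x, ← hf (m * r + x)]
      ring_nf
  induction c with
  | zero => simp
  | succ c ih =>
    rw [Nat.succ_mul, sum_range_add, ih]
    simp only [hper]
    push_cast
    ring

lemma warGauss_eq_sum_range (k q a : ℕ) [NeZero q] :
    warGauss k q a = (q : ℂ)⁻¹ * ∑ r ∈ range q, e ((a : ℝ) * (r : ℝ) ^ k / (q : ℝ)) := by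
  rw [warGauss_eq_sum_zmod, ← sum_range_natCast_zmod]
  congr 1
  refine sum_congr rfl fun r _ => ?_
  have h := e_natCast_div q (a * r ^ k)
  push_cast at h
  exact h.symm

lemma e_mul_pow_div_periodic (k r a : ℕ) [NeZero r] (x : ℕ) :
    e ((a : ℝ) * ((x + r : ℕ) : ℝ) ^ k / (r : ℝ)) = e ((a : ℝ) * (x : ℝ) ^ k / (r : ℝ)) := by
  have h := e_natCast_div r (a * (x + r) ^ k)
  have h' := e_natCast_div r (a * x ^ k)
  push_cast at h h' ⊢
  rw [h, h']
  simp

lemma warGauss_mul_mul (k c r a : ℕ) [NeZero c] [NeZero r] :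
    warGauss k (c * r) (c * a) = warGauss k r a := by
  rw [warGauss_eq_sum_range, warGauss_eq_sum_range]
  have hc : (c : ℝ) ≠ 0 := by exact_mod_cast NeZero.ne c
  have hc' : (c : ℂ) ≠ 0 := by exact_mod_cast NeZero.ne c
  have hfrac : ∀ x : ℕ, ((c * a : ℕ) : ℝ) * (x : ℝ) ^ k / ((c * r : ℕ) : ℝ)
      = (a : ℝ) * (x : ℝ) ^ k / (r : ℝ) := by
    intro x
    push_cast
    rw [mul_assoc, mul_div_mul_left _ _ hc]
  simp only [hfrac]
  rw [sum_range_mul_of_periodic _ c r (e_mul_pow_div_periodic k r a)]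
  push_cast
  field_simp

/-- The number of solutions of `x₁ ^ k + ⋯ + x_d ^ k = N` in `ZMod q`. -/
noncomputable def solutionCount (k d N q : ℕ) : ℕ :=
  Nat.card {x : Fin d → ZMod q // ∑ i, x i ^ k = (N : ZMod q)}

/-- The normalised number of solutions `q ^ (1 - d) * #{x mod q : x₁ ^ k + ⋯ + x_d ^ k = N}`. -/
noncomputable def localDensity (k d N : ℕ) : ArithmeticFunction ℝ :=
  ⟨fun q => solutionCount k d N q * q / (q : ℝ) ^ d, by simp⟩

/-- The `q`-th term of the singular series. -/
noncomputable def singularTerm (k d N q : ℕ) : ℂ :=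
  ∑ a ∈ (Icc 1 q).filter (fun a => Nat.Coprime a q),
    (warGauss k q a) ^ d * e (-((N : ℝ) * a / q))

/-- The terms of the singular series, obtained from the local densities by Möbius inversion. -/
noncomputable def densityIncrement (k d N : ℕ) : ArithmeticFunction ℝ :=
  localDensity k d N * (ArithmeticFunction.moebius : ArithmeticFunction ℝ)

lemma sum_stdAddChar_pow (k d q : ℕ) [NeZero q] (a : ZMod q) :
    (∑ x : ZMod q, ZMod.stdAddChar (a * x ^ k)) ^ d
      = ∑ x : Fin d → ZMod q, (ZMod.stdAddChar (a * ∑ i, x i ^ k) : ℂ) := by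
  rw [Fintype.sum_pow]
  refine sum_congr rfl fun x _ => ?_
  rw [mul_sum]
  exact (map_prod (ZMod.stdAddChar (N := q)).toMonoidHom
    (fun i => Multiplicative.ofAdd (a * x i ^ k)) univ).symm

lemma localDensity_eq_sum_warGauss (k d N q : ℕ) [NeZero q] :
    ((localDensity k d N q : ℝ) : ℂ)
      = ∑ a ∈ Icc 1 q, warGauss k q a ^ d * e (-((N : ℝ) * a / q)) := by
  classical
  have hq : (q : ℂ) ≠ 0 := by exact_mod_cast NeZero.ne q
  have hterm : ∀ a : ℕ, warGauss k q a ^ d * e (-((N : ℝ) * a / q))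
      = ((q : ℂ) ^ d)⁻¹ * ∑ x : Fin d → ZMod q,
        (ZMod.stdAddChar ((a : ZMod q) * (∑ i, x i ^ k - (N : ZMod q))) : ℂ) := by
    intro a
    have h := e_intCast_div q (-(N * a : ℤ))
    have h2 : (-((N : ℝ) * a / q)) = ((-(N * a : ℤ) : ℤ) : ℝ) / q := by push_cast; ring
    rw [h2, h, warGauss_eq_sum_zmod, mul_pow, sum_stdAddChar_pow, inv_pow, mul_assoc, sum_mul]
    congr 1
    refine sum_congr rfl fun x _ => ?_
    rw [← AddChar.map_add_eq_mul]
    congr 1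
    push_cast
    ring
  simp only [hterm]
  rw [← mul_sum, sum_Icc_natCast_zmod q (fun a : ZMod q => ∑ x : Fin d → ZMod q,
        (ZMod.stdAddChar (a * (∑ i, x i ^ k - (N : ZMod q))) : ℂ)), sum_comm]
  simp only [AddChar.sum_mulShift _ (ZMod.isPrimitive_stdAddChar q), ZMod.card]
  have hcount : solutionCount k d N q
      = #{x : Fin d → ZMod q | ∑ i, x i ^ k = (N : ZMod q)} := by
    rw [solutionCount, Nat.card_eq_fintype_card, Fintype.card_subtype]
  simp only [localDensity, ArithmeticFunction.coe_mk, hcount, sub_eq_zero]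
  rw [← Nat.cast_sum, sum_ite, sum_const, sum_const_zero]
  push_cast
  simp only [smul_eq_mul, add_zero, Nat.cast_mul]
  field_simp

lemma sum_Icc_eq_sum_divisors_coprime (f : ℕ → ℕ → ℂ) (q : ℕ) (hq : q ≠ 0)
    (hf : ∀ c r a : ℕ, c ≠ 0 → r ≠ 0 → f (c * r) (c * a) = f r a) :
    ∑ a ∈ Icc 1 q, f q a
      = ∑ r ∈ q.divisors, ∑ a ∈ (Icc 1 r).filter (fun a => Nat.Coprime a r), f r a := by
  rw [← sum_fiberwise_of_maps_to (s := Icc 1 q) (t := q.divisors) (g := fun a => q / a.gcd q)]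
  · refine sum_congr rfl fun r hr => ?_
    obtain ⟨c, rfl⟩ := Nat.dvd_of_mem_divisors hr
    have hr0 : 0 < r := Nat.pos_of_ne_zero (left_ne_zero_of_mul hq)
    have hc0 : 0 < c := Nat.pos_of_ne_zero (right_ne_zero_of_mul hq)
    have hgcd : ∀ a : ℕ, r * c / a.gcd (r * c) = r → a.gcd (r * c) = c := by
      intro a ha
      have h1 := Nat.div_mul_cancel (Nat.gcd_dvd_right a (r * c))
      rw [ha] at h1
      exact Nat.eq_of_mul_eq_mul_left hr0 h1
    refine sum_nbij' (fun a => a / c) (fun b => c * b) ?_ ?_ ?_ ?_ ?_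
    · intro a ha
      simp only [mem_filter, mem_Icc] at ha ⊢
      have hg := hgcd a ha.2
      obtain ⟨b, rfl⟩ : c ∣ a := hg ▸ Nat.gcd_dvd_left a (r * c)
      rw [Nat.mul_div_cancel_left _ hc0]
      rw [mul_comm r c, Nat.gcd_mul_left] at hg
      refine ⟨⟨?_, ?_⟩, ?_⟩
      · rcases Nat.eq_zero_or_pos b with rfl | h
        · simp at ha
        · exact h
      · have := ha.1.2
        rw [mul_comm r c] at this
        exact Nat.le_of_mul_le_mul_left this hc0
      · exact Nat.eq_of_mul_eq_mul_left hc0 (by simpa using hg)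
    · intro b hb
      simp only [mem_filter, mem_Icc] at hb ⊢
      refine ⟨⟨Nat.mul_pos hc0 hb.1.1, ?_⟩, ?_⟩
      · rw [mul_comm r c]
        exact Nat.mul_le_mul_left c hb.1.2
      · rw [mul_comm r c, Nat.gcd_mul_left, hb.2.gcd_eq_one, mul_one, Nat.mul_div_cancel_left _ hc0]
    · intro a ha
      simp only [mem_filter, mem_Icc] at ha
      exact Nat.mul_div_cancel' (hgcd a ha.2 ▸ Nat.gcd_dvd_left a (r * c))
    · intro b _
      exact Nat.mul_div_cancel_left _ hc0
    · intro a ha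
      simp only [mem_filter, mem_Icc] at ha
      have hca : c ∣ a := hgcd a ha.2 ▸ Nat.gcd_dvd_left a (r * c)
      obtain ⟨b, rfl⟩ := hca
      rw [Nat.mul_div_cancel_left _ hc0, mul_comm r c, hf c r b hc0.ne' hr0.ne']
  · intro a _
    exact Nat.mem_divisors.2 ⟨Nat.div_dvd_of_dvd (Nat.gcd_dvd_right a q), hq⟩

lemma localDensity_eq_sum_singularTerm (k d N q : ℕ) (hq : q ≠ 0) :
    ((localDensity k d N q : ℝ) : ℂ) = ∑ r ∈ q.divisors, singularTerm k d N r := by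
  have : NeZero q := ⟨hq⟩
  rw [localDensity_eq_sum_warGauss]
  refine sum_Icc_eq_sum_divisors_coprime
    (fun q a => warGauss k q a ^ d * e (-((N : ℝ) * a / q))) q hq ?_
  intro c r a hc hr
  have : NeZero c := ⟨hc⟩
  have : NeZero r := ⟨hr⟩
  have hc' : (c : ℝ) ≠ 0 := by exact_mod_cast hc
  simp only [warGauss_mul_mul]
  congr 3
  push_cast
  rw [mul_left_comm, mul_div_mul_left _ _ hc']

lemma singularTerm_eq_densityIncrement (k d N q : ℕ) :
    singularTerm k d N q = ((densityIncrement k d N q : ℝ) : ℂ) := by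
  rcases Nat.eq_zero_or_pos q with rfl | hq
  · simp [singularTerm]
  have h := (ArithmeticFunction.sum_eq_iff_sum_mul_moebius_eq
    (f := singularTerm k d N) (g := fun q => ((localDensity k d N q : ℝ) : ℂ))).1
    (fun n hn => (localDensity_eq_sum_singularTerm k d N n hn.ne').symm) q hq
  rw [← h, densityIncrement, mul_comm, ArithmeticFunction.mul_apply]
  push_cast
  simp

lemma sum_range_densityIncrement_prime_pow (k d N p h : ℕ) (hp : p.Prime) :
    ∑ i ∈ range (h + 1), densityIncrement k d N (p ^ i) = localDensity k d N (p ^ h) := by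
  rw [← Nat.sum_divisors_prime_pow hp, ← ArithmeticFunction.coe_mul_zeta_apply, densityIncrement,
    mul_assoc, ArithmeticFunction.coe_moebius_mul_coe_zeta, mul_one]

lemma solutionCount_mul (k d N m n : ℕ) (h : m.Coprime n) :
    solutionCount k d N (m * n) = solutionCount k d N m * solutionCount k d N n := by
  rw [solutionCount, solutionCount, solutionCount, ← Nat.card_prod]
  let φ := ZMod.chineseRemainder h
  refine Nat.card_congr ?_
  refine Equiv.trans (Equiv.subtypeEquiv
    (q := fun y : (Fin d → ZMod m) × (Fin d → ZMod n) =>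
      ∑ i, y.1 i ^ k = (N : ZMod m) ∧ ∑ i, y.2 i ^ k = (N : ZMod n))
    ((Equiv.piCongrRight fun _ : Fin d => φ.toEquiv).trans (Equiv.arrowProdEquivProdArrow _ _ _))
    ?_) (Equiv.subtypeProdEquivProd
      (p := fun x : Fin d → ZMod m => ∑ i, x i ^ k = (N : ZMod m))
      (q := fun x : Fin d → ZMod n => ∑ i, x i ^ k = (N : ZMod n)))
  intro x
  rw [← φ.injective.eq_iff, map_sum, map_natCast, Prod.ext_iff]
  simp [Prod.fst_sum, Prod.snd_sum]

lemma isMultiplicative_localDensity (k d N : ℕ) :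
    (localDensity k d N).IsMultiplicative := by
  refine ⟨?_, ?_⟩
  · have : solutionCount k d N 1 = 1 := by
      rw [solutionCount, Nat.card_eq_one_iff_unique]
      exact ⟨inferInstance, ⟨⟨0, Subsingleton.elim _ _⟩⟩⟩
    simp [localDensity, this]
  · intro m n h
    simp only [localDensity, ArithmeticFunction.coe_mk, solutionCount_mul k d N m n h]
    push_cast
    rw [mul_pow, div_mul_div_comm]
    ring

lemma isMultiplicative_densityIncrement (k d N : ℕ) :
    (densityIncrement k d N).IsMultiplicative :=
  (isMultiplicative_localDensity k d N).mul ArithmeticFunction.isMultiplicative_moebius.intCast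

lemma sum_range_stdAddChar_mul_eq_zero (p q : ℕ) [NeZero q] (c : ZMod q) (hc : c ≠ 0)
    (hpc : (p : ZMod q) * c = 0) :
    ∑ v ∈ range p, (ZMod.stdAddChar (c * (v : ZMod q)) : ℂ) = 0 := by
  have hpow : ∀ v : ℕ, (ZMod.stdAddChar (c * (v : ZMod q)) : ℂ) = ZMod.stdAddChar c ^ v := by
    intro v
    rw [← AddChar.map_nsmul_eq_pow, nsmul_eq_mul, mul_comm]
  simp only [hpow]
  have hne : (ZMod.stdAddChar c : ℂ) - 1 ≠ 0 := by
    rw [sub_ne_zero, ← AddChar.map_zero_eq_one (ZMod.stdAddChar (N := q))]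
    exact fun h => hc (ZMod.injective_stdAddChar h)
  have h := mul_geom_sum (ZMod.stdAddChar c : ℂ) p
  rw [← hpow, mul_comm c, hpc, AddChar.map_zero_eq_one, sub_self] at h
  exact (mul_eq_zero.1 h).resolve_left hne

lemma sum_isUnit_stdAddChar_eq_zero (p k h : ℕ) [Fact p.Prime] (hk : k ≠ 0)
    (hh : 2 * padicValNat p k + 2 ≤ h) (a : ZMod (p ^ h)) (ha : IsUnit a) :
    ∑ x : ZMod (p ^ h) with IsUnit x, (ZMod.stdAddChar (a * x ^ k) : ℂ) = 0 := by
  have hp : p.Prime := Fact.out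
  obtain ⟨m, hm⟩ : ∃ m, h = m + padicValNat p k + 1 := ⟨h - padicValNat p k - 1, by omega⟩
  have hzero : ∀ n : ℕ, h ≤ n → (p : ZMod (p ^ h)) ^ n = 0 := by
    intro n hn
    rw [← Nat.cast_pow, ZMod.natCast_eq_zero_iff]
    exact pow_dvd_pow p hn
  have hkm : (k : ZMod (p ^ h)) * (p : ZMod (p ^ h)) ^ m ≠ 0 := by
    rw [← Nat.cast_pow, ← Nat.cast_mul, Ne, ZMod.natCast_eq_zero_iff,
      padicValNat_dvd_iff_le (mul_ne_zero hk (pow_ne_zero _ hp.ne_zero)),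
      padicValNat.mul hk (pow_ne_zero _ hp.ne_zero), padicValNat.prime_pow]
    omega
  have hpkm : (p : ZMod (p ^ h)) * ((k : ZMod (p ^ h)) * (p : ZMod (p ^ h)) ^ m) = 0 := by
    obtain ⟨k', hk'⟩ := pow_padicValNat_dvd (p := p) (n := k)
    generalize padicValNat p k = τ at *
    have : (p : ZMod (p ^ h)) * ((k : ZMod (p ^ h)) * (p : ZMod (p ^ h)) ^ m)
        = (p : ZMod (p ^ h)) ^ (m + τ + 1) * k' := by
      rw [hk']
      push_cast
      ring
    rw [this, hzero _ hm.le, zero_mul]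
  have hnil : ∀ v : ZMod (p ^ h), IsNilpotent ((p : ZMod (p ^ h)) ^ m * (v : ZMod (p ^ h))) := by
    intro v
    refine ⟨h, ?_⟩
    rw [mul_pow, ← pow_mul, hzero _ (Nat.le_mul_of_pos_left h (by omega)), zero_mul]
  have hshift : ∀ v : ℕ, ∑ x : ZMod (p ^ h) with IsUnit x, (ZMod.stdAddChar (a * x ^ k) : ℂ)
      = ∑ x : ZMod (p ^ h) with IsUnit x, (ZMod.stdAddChar (a * x ^ k) : ℂ) *
        ZMod.stdAddChar ((a * x ^ (k - 1) * ((k : ZMod (p ^ h)) * (p : ZMod (p ^ h)) ^ m)) * (v : ZMod (p ^ h))) := by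
    intro v
    rw [← sum_equiv (Equiv.addRight ((p : ZMod (p ^ h)) ^ m * (v : ZMod (p ^ h))))
      (s := univ.filter fun x : ZMod (p ^ h) => IsUnit x)
      (t := univ.filter fun x : ZMod (p ^ h) => IsUnit x)
      (f := fun x => (ZMod.stdAddChar (a * (x + (p : ZMod (p ^ h)) ^ m * (v : ZMod (p ^ h))) ^ k) : ℂ))]
    · refine sum_congr rfl fun x _ => ?_
      obtain ⟨z, hz⟩ := Polynomial.powAddExpansion x ((p : ZMod (p ^ h)) ^ m * (v : ZMod (p ^ h))) k
      rw [hz, ← AddChar.map_add_eq_mul]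
      congr 1
      have : ((p : ZMod (p ^ h)) ^ m * (v : ZMod (p ^ h))) ^ 2 = 0 := by
        rw [mul_pow, ← pow_mul, hzero _ (by omega), zero_mul]
      rw [this]
      ring
    · intro x
      simp only [mem_filter, mem_univ, true_and, Equiv.coe_addRight]
      refine ⟨fun hx => (hnil v).isUnit_add_left_of_commute hx (Commute.all _ _), fun hx => ?_⟩
      simpa using (hnil v).neg.isUnit_add_left_of_commute hx (Commute.all _ _)
    · intro x _
      rfl
  have hp0 : (p : ℂ) ≠ 0 := by exact_mod_cast hp.ne_zero
  refine (mul_eq_zero.1 ?_).resolve_left hp0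
  calc (p : ℂ) * ∑ x : ZMod (p ^ h) with IsUnit x, (ZMod.stdAddChar (a * x ^ k) : ℂ)
      = ∑ v ∈ range p, ∑ x : ZMod (p ^ h) with IsUnit x, (ZMod.stdAddChar (a * x ^ k) : ℂ) := by
        simp
    _ = ∑ v ∈ range p, ∑ x : ZMod (p ^ h) with IsUnit x, (ZMod.stdAddChar (a * x ^ k) : ℂ) *
        ZMod.stdAddChar ((a * x ^ (k - 1) * ((k : ZMod (p ^ h)) * (p : ZMod (p ^ h)) ^ m)) * (v : ZMod (p ^ h))) :=
        sum_congr rfl fun v _ => hshift v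
    _ = 0 := by
        rw [sum_comm]
        refine sum_eq_zero fun x hx => ?_
        have hx' : IsUnit x := (mem_filter.1 hx).2
        rw [← mul_sum, sum_range_stdAddChar_mul_eq_zero, mul_zero]
        · rw [Ne, (ha.mul (hx'.pow _)).mul_right_eq_zero]
          exact hkm
        · rw [mul_left_comm, hpkm, mul_zero]

lemma sum_not_isUnit_zmod_prime_pow (p h : ℕ) [Fact p.Prime] (f : ZMod (p ^ (h + 1)) → ℂ) :
    ∑ x : ZMod (p ^ (h + 1)) with ¬ IsUnit x, f x
      = ∑ s ∈ range (p ^ h), f ((p * s : ℕ) : ZMod (p ^ (h + 1))) := by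
  have hp : p.Prime := Fact.out
  have hunit : ∀ n : ℕ, ¬ IsUnit (n : ZMod (p ^ (h + 1))) ↔ p ∣ n := by
    intro n
    rw [ZMod.isUnit_iff_coprime, Nat.coprime_pow_right_iff (Nat.succ_pos h), Nat.coprime_comm,
      hp.coprime_iff_not_dvd, not_not]
  have hlt : ∀ s, s < p ^ h → p * s < p ^ (h + 1) := by
    intro s hs
    rw [pow_succ']
    exact Nat.mul_lt_mul_of_pos_left hs hp.pos
  symm
  refine sum_nbij' (fun s => ((p * s : ℕ) : ZMod (p ^ (h + 1)))) (fun x => x.val / p) ?_ ?_ ?_ ?_ ?_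
  · intro s _
    simp only [mem_filter, mem_univ, true_and]
    rw [hunit]
    exact dvd_mul_right _ _
  · intro x _
    rw [mem_range]
    exact Nat.div_lt_of_lt_mul ((ZMod.val_lt x).trans_eq (pow_succ' p h))
  · intro s hs
    rw [ZMod.val_cast_of_lt (hlt s (mem_range.1 hs)), Nat.mul_div_cancel_left _ hp.pos]
  · intro x hx
    have hx' := (mem_filter.1 hx).2
    rw [← ZMod.natCast_zmod_val x, hunit] at hx'
    rw [Nat.mul_div_cancel' hx', ZMod.natCast_zmod_val]
  · intro s _
    rfl

lemma warGauss_prime_pow (p k h a : ℕ) [Fact p.Prime] (hk : k ≠ 0) (ha : a.Coprime p)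
    (hh : 2 * padicValNat p k + 2 ≤ h) :
    warGauss k (p ^ h) a = (p : ℂ)⁻¹ * warGauss k (p ^ (h - k)) a := by
  have hp : p.Prime := Fact.out
  have hp0 : (p : ℂ) ≠ 0 := by exact_mod_cast hp.ne_zero
  have hp1 : (p : ℝ) ≠ 0 := by exact_mod_cast hp.ne_zero
  have ha' : IsUnit (a : ZMod (p ^ h)) := (ZMod.isUnit_iff_coprime _ _).2 (ha.pow_right h)
  rw [warGauss_eq_sum_zmod, ← sum_filter_add_sum_filter_not _ (fun x => IsUnit x),
    sum_isUnit_stdAddChar_eq_zero p k h hk hh _ ha', zero_add]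
  obtain ⟨h, rfl⟩ : ∃ h', h = h' + 1 := ⟨h - 1, by omega⟩
  rw [sum_not_isUnit_zmod_prime_pow p h (fun x => (ZMod.stdAddChar ((a : ZMod (p ^ (h + 1))) * x ^ k) : ℂ))]
  rcases le_or_gt (h + 1) k with hle | hlt
  · have hone : ∀ s : ℕ, (ZMod.stdAddChar ((a : ZMod (p ^ (h + 1))) *
        ((p * s : ℕ) : ZMod (p ^ (h + 1))) ^ k) : ℂ) = 1 := by
      intro s
      have : (a : ZMod (p ^ (h + 1))) * ((p * s : ℕ) : ZMod (p ^ (h + 1))) ^ k = 0 := by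
        rw [← Nat.cast_pow, ← Nat.cast_mul, ZMod.natCast_eq_zero_iff, mul_pow]
        exact ((pow_dvd_pow p hle).mul_right _).mul_left _
      rw [this, AddChar.map_zero_eq_one]
    simp only [hone, Nat.sub_eq_zero_of_le hle, pow_zero]
    rw [warGauss_eq_sum_zmod]
    simp only [sum_const, card_range, nsmul_eq_mul, mul_one, Nat.cast_pow, pow_succ]
    have h1 : ∀ x : ZMod 1, (ZMod.stdAddChar ((a : ZMod 1) * x ^ k) : ℂ) = 1 := by
      intro x
      rw [Subsingleton.elim ((a : ZMod 1) * x ^ k) 0, AddChar.map_zero_eq_one]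
    simp only [h1]
    simp
    field_simp
  · obtain ⟨j, hj⟩ : ∃ j, h + 1 = j + k := ⟨h + 1 - k, by omega⟩
    obtain ⟨k, rfl⟩ : ∃ k', k = k' + 1 := ⟨k - 1, by omega⟩
    obtain rfl : h = j + k := by omega
    rw [show j + k + 1 - (k + 1) = j by omega, warGauss_eq_sum_range]
    have hterm : ∀ s : ℕ, (ZMod.stdAddChar ((a : ZMod (p ^ (j + k + 1))) *
        ((p * s : ℕ) : ZMod (p ^ (j + k + 1))) ^ (k + 1)) : ℂ)
        = e ((a : ℝ) * (s : ℝ) ^ (k + 1) / ((p ^ j : ℕ) : ℝ)) := by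
      intro s
      rw [← Nat.cast_pow, ← Nat.cast_mul, ← e_natCast_div]
      congr 1
      push_cast
      rw [mul_pow]
      field_simp
      ring
    simp only [hterm]
    rw [show p ^ (j + k) = p ^ k * p ^ j by ring, sum_range_mul_of_periodic _ _ _
      (e_mul_pow_div_periodic (k + 1) (p ^ j) a)]
    push_cast
    field_simp
    ring

lemma card_pow_eq_le {F : Type*} [Field F] [Fintype F] [DecidableEq F] (k : ℕ) (hk : 0 < k)
    (c : F) : #{y : F | y ^ k = c} ≤ k := by
  have : ({y : F | y ^ k = c} : Finset F) = (Polynomial.nthRoots k c).toFinset := by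
    ext y
    simp [Polynomial.mem_nthRoots hk]
  rw [this]
  exact (Multiset.toFinset_card_le _).trans (Polynomial.card_nthRoots k c)

lemma sum_norm_sq_sum_stdAddChar_le (p k : ℕ) [Fact p.Prime] (hk : 0 < k) :
    ∑ b : ZMod p, ‖∑ x : ZMod p, (ZMod.stdAddChar (b * x ^ k) : ℂ)‖ ^ 2 ≤ (p : ℝ) ^ 2 * k := by
  have hsq : ∀ b : ZMod p, ((‖∑ x : ZMod p, (ZMod.stdAddChar (b * x ^ k) : ℂ)‖ ^ 2 : ℝ) : ℂ)
      = ∑ x : ZMod p, ∑ y : ZMod p, (ZMod.stdAddChar (b * (x ^ k - y ^ k)) : ℂ) := by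
    intro b
    rw [Complex.ofReal_pow, ← Complex.mul_conj', map_sum, sum_mul_sum]
    refine sum_congr rfl fun x _ => sum_congr rfl fun y _ => ?_
    rw [← AddChar.map_neg_eq_conj, ← AddChar.map_add_eq_mul]
    ring_nf
  have hmain : ∑ b : ZMod p, ‖∑ x : ZMod p, (ZMod.stdAddChar (b * x ^ k) : ℂ)‖ ^ 2
      = ((∑ x : ZMod p, p * #{y : ZMod p | y ^ k = x ^ k} : ℕ) : ℝ) := by
    apply Complex.ofReal_injective
    rw [Complex.ofReal_sum]
    simp only [hsq]
    rw [sum_comm]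
    push_cast
    refine sum_congr rfl fun x _ => ?_
    rw [sum_comm]
    simp only [AddChar.sum_mulShift _ (ZMod.isPrimitive_stdAddChar p), ZMod.card, sub_eq_zero]
    rw [← Nat.cast_sum, sum_ite, sum_const, sum_const_zero]
    simp only [eq_comm (a := x ^ k)]
    push_cast
    simp [mul_comm]
  rw [hmain]
  have : ∑ x : ZMod p, p * #{y : ZMod p | y ^ k = x ^ k} ≤ p ^ 2 * k := by
    calc ∑ x : ZMod p, p * #{y : ZMod p | y ^ k = x ^ k}
        ≤ ∑ _x : ZMod p, p * k :=
          sum_le_sum fun x _ => Nat.mul_le_mul_left p (card_pow_eq_le k hk _)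
      _ = p ^ 2 * k := by
          simp [ZMod.card]
          ring
  exact_mod_cast this

lemma norm_warGauss_prime_sq_le (p k a : ℕ) [Fact p.Prime] (hk : 0 < k) (ha : a.Coprime p) :
    (p : ℝ) * ‖warGauss k p a‖ ^ 2 ≤ 2 * (k : ℝ) ^ 2 := by
  have hp : p.Prime := Fact.out
  have ha0 : (a : ZMod p) ≠ 0 := ((ZMod.isUnit_iff_coprime a p).2 ha).ne_zero
  set S : ZMod p → ℂ := fun b => ∑ x : ZMod p, (ZMod.stdAddChar (b * x ^ k) : ℂ) with hS
  have hinv : ∀ t : ZMod p, t ≠ 0 → S (a * t ^ k) = S a := by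
    intro t ht
    simp only [hS]
    refine Fintype.sum_equiv (Equiv.mulLeft₀ t ht) _ _ fun x => ?_
    rw [Equiv.mulLeft₀_apply]
    ring_nf
  have hfib : ∑ t : ZMod p with t ≠ 0, ‖S (a * t ^ k)‖ ^ 2 ≤ k * ∑ b : ZMod p, ‖S b‖ ^ 2 := by
    rw [← sum_fiberwise_of_maps_to (s := univ.filter fun t : ZMod p => t ≠ 0) (t := univ)
      (g := fun t : ZMod p => (a : ZMod p) * t ^ k) (fun _ _ => mem_univ _), mul_sum]
    refine sum_le_sum fun b _ => ?_
    rw [sum_congr rfl (g := fun _ => ‖S b‖ ^ 2) (fun t ht => by rw [(mem_filter.1 ht).2]),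
      sum_const, nsmul_eq_mul]
    refine mul_le_mul_of_nonneg_right ?_ (by positivity)
    refine Nat.cast_le.2 ((card_le_card ?_).trans (card_pow_eq_le k hk (b / (a : ZMod p))))
    intro t ht
    simp only [mem_filter, mem_univ, true_and] at ht ⊢
    rw [← ht.2]
    field_simp
  have hcard : ∑ t : ZMod p with t ≠ 0, ‖S (a * t ^ k)‖ ^ 2 = ((p : ℝ) - 1) * ‖S a‖ ^ 2 := by
    rw [sum_congr rfl (g := fun _ => ‖S a‖ ^ 2)
      (fun t ht => by rw [hinv t (mem_filter.1 ht).2]), sum_const, nsmul_eq_mul]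
    congr 1
    rw [filter_ne', card_erase_of_mem (mem_univ _), card_univ, ZMod.card, Nat.cast_sub hp.one_le,
      Nat.cast_one]
  have hle : ((p : ℝ) - 1) * ‖S a‖ ^ 2 ≤ (k : ℝ) * ((p : ℝ) ^ 2 * k) := by
    rw [← hcard]
    exact hfib.trans (mul_le_mul_of_nonneg_left (sum_norm_sq_sum_stdAddChar_le p k hk)
      (Nat.cast_nonneg k))
  have hG : ‖S a‖ ^ 2 = (p : ℝ) ^ 2 * ‖warGauss k p a‖ ^ 2 := by
    have hp0 : (p : ℝ) ≠ 0 := by exact_mod_cast hp.ne_zero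
    rw [warGauss_eq_sum_zmod, norm_mul, norm_inv, Complex.norm_natCast, mul_pow]
    field_simp
    rfl
  rw [hG] at hle
  have hp2 : (2 : ℝ) ≤ p := by exact_mod_cast hp.two_le
  have hle' : ((p : ℝ) - 1) * ‖warGauss k p a‖ ^ 2 ≤ (k : ℝ) ^ 2 := by
    have hpp : (0 : ℝ) < (p : ℝ) ^ 2 := by positivity
    refine le_of_mul_le_mul_left ?_ hpp
    linarith
  nlinarith [sq_nonneg ‖warGauss k p a‖]

/-- The saving exponent used for the normalised Gauss sums, slightly smaller than `1 / k`. -/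
noncomputable def gaussExponent (k : ℕ) : ℝ := 4 / (4 * k + 1)

lemma gaussExponent_pos (k : ℕ) : 0 < gaussExponent k := by
  unfold gaussExponent
  positivity

lemma gaussExponent_mul_le_one (k : ℕ) : gaussExponent k * k ≤ 1 := by
  unfold gaussExponent
  rw [div_mul_eq_mul_div, div_le_one (by positivity)]
  linarith

lemma gaussExponent_lt_half (k : ℕ) (hk : 2 ≤ k) : gaussExponent k < 1 / 2 := by
  unfold gaussExponent
  have : (2 : ℝ) ≤ k := by exact_mod_cast hk
  rw [div_lt_div_iff₀ (by positivity) (by norm_num)]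
  linarith

lemma two_lt_gaussExponent_mul (k : ℕ) (hk : 2 ≤ k) :
    2 < gaussExponent k * ((2 ^ k + 1 : ℕ) : ℝ) := by
  have h : 2 * k ≤ 2 ^ k := by
    induction k, hk using Nat.le_induction with
    | base => norm_num
    | succ n hn ih =>
      rw [pow_succ]
      omega
  have h' : 2 * (k : ℝ) ≤ 2 ^ k := by exact_mod_cast h
  unfold gaussExponent
  rw [div_mul_eq_mul_div, lt_div_iff₀ (by positivity)]
  push_cast
  linarith

lemma le_rpow_of_recursion (g : ℕ → ℝ) (p : ℝ) (hp : 1 ≤ p) (k m : ℕ) (η C : ℝ)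
    (hk : 0 < k) (hη : 0 < η) (hηk : η * k ≤ 1) (hC : 1 ≤ C) (hg : ∀ h, g h ≤ 1)
    (hsmall : ∀ h < m, g h ≤ C * p ^ (-(η * h))) (hrec : ∀ h, m ≤ h → g h ≤ p⁻¹ * g (h - k)) :
    ∀ h, g h ≤ C * p ^ (-(η * h)) := by
  have hp0 : 0 < p := by linarith
  intro h
  induction h using Nat.strong_induction_on with
  | _ h ih =>
    rcases lt_or_ge h m with hlt | hge
    · exact hsmall h hlt
    rcases le_or_gt k h with hkh | hkh
    · have hih := ih (h - k) (by omega)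
      calc g h ≤ p⁻¹ * g (h - k) := hrec h hge
        _ ≤ p⁻¹ * (C * p ^ (-(η * (h - k : ℕ)))) :=
            mul_le_mul_of_nonneg_left hih (by positivity)
        _ = C * p ^ (-1 + -(η * (h - k : ℕ))) := by
            rw [Real.rpow_add hp0, Real.rpow_neg_one]
            ring
        _ ≤ C * p ^ (-(η * h)) := by
            refine mul_le_mul_of_nonneg_left ?_ (by linarith)
            refine Real.rpow_le_rpow_of_exponent_le hp ?_
            rw [Nat.cast_sub hkh]
            nlinarith
    · calc g h ≤ p⁻¹ * g (h - k) := hrec h hge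
        _ ≤ p⁻¹ * 1 := mul_le_mul_of_nonneg_left (hg _) (by positivity)
        _ = p ^ (-1 : ℝ) := by rw [Real.rpow_neg_one, mul_one]
        _ ≤ p ^ (-(η * h)) := by
            refine Real.rpow_le_rpow_of_exponent_le hp ?_
            have : (h : ℝ) ≤ k := by exact_mod_cast hkh.le
            nlinarith
        _ ≤ C * p ^ (-(η * h)) := le_mul_of_one_le_left (by positivity) hC

lemma exists_norm_warGauss_prime_pow_le (k : ℕ) (hk : 2 ≤ k) :
    ∃ (P : ℕ) (C : ℕ → ℝ), (∀ p, 1 ≤ C p) ∧ (∀ p, P ≤ p → C p = 1) ∧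
      ∀ p : ℕ, p.Prime → ∀ h a : ℕ, a.Coprime p →
        ‖warGauss k (p ^ h) a‖ ≤ C p * (p : ℝ) ^ (-(gaussExponent k * h)) := by
  set η := gaussExponent k with hη
  have hη0 : 0 < η := gaussExponent_pos k
  have hηk : η * k ≤ 1 := gaussExponent_mul_le_one k
  have hη2 : η < 1 / 2 := gaussExponent_lt_half k hk
  have hev : ∀ᶠ n : ℕ in Filter.atTop, 2 * (k : ℝ) ^ 2 ≤ (n : ℝ) ^ (1 - 2 * η) :=
    ((tendsto_rpow_atTop (by linarith)).comp tendsto_natCast_atTop_atTop).eventually_ge_atTop _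
  obtain ⟨P₀, hP₀⟩ := Filter.eventually_atTop.1 hev
  refine ⟨max P₀ (k + 1), fun p => if max P₀ (k + 1) ≤ p then 1 else
    ((p : ℝ) + 1) ^ (2 * padicValNat p k + 2), ?_, ?_, ?_⟩
  · intro p
    dsimp only
    split_ifs
    · exact le_rfl
    · exact one_le_pow₀ (by linarith [Nat.cast_nonneg (α := ℝ) p])
  · intro p hp
    exact if_pos hp
  · intro p hp h a ha
    have : Fact p.Prime := ⟨hp⟩
    have hp1 : (1 : ℝ) ≤ p := by exact_mod_cast hp.one_le
    have hp0 : (0 : ℝ) < p := by linarith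
    have hrec : ∀ h, 2 * padicValNat p k + 2 ≤ h →
        ‖warGauss k (p ^ h) a‖ ≤ (p : ℝ)⁻¹ * ‖warGauss k (p ^ (h - k)) a‖ := by
      intro h hh
      rw [warGauss_prime_pow p k h a (by omega) ha hh, norm_mul, norm_inv, Complex.norm_natCast]
    refine le_rpow_of_recursion (fun h => ‖warGauss k (p ^ h) a‖) p hp1 k
      (2 * padicValNat p k + 2) η _ (by omega) hη0 hηk ?_
      (fun h => norm_warGauss_le_one _ _ _) ?_ hrec h
    · dsimp only
      split_ifs
      · exact le_rfl
      · exact one_le_pow₀ (by linarith)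
    · intro h hh
      dsimp only
      split_ifs with hP
      · have hpk : padicValNat p k = 0 := by
          refine padicValNat.eq_zero_of_not_dvd fun hdvd => ?_
          have := Nat.le_of_dvd (by omega) hdvd
          have := le_of_max_le_right hP
          omega
        rw [hpk] at hh
        obtain rfl | rfl : h = 0 ∨ h = 1 := by omega
        · simpa using norm_warGauss_le_one k 1 a
        · simp only [pow_one, Nat.cast_one, mul_one, one_mul]
          have hsq := norm_warGauss_prime_sq_le p k a (by omega) ha
          have hbig := hP₀ p (le_of_max_le_left hP)
          refine le_of_sq_le_sq ?_ (by positivity)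
          rw [← Real.rpow_natCast, ← Real.rpow_natCast, ← Real.rpow_mul hp0.le]
          have hle := hsq.trans hbig
          rw [← le_div_iff₀' hp0] at hle
          refine le_trans (by simpa using hle) (le_of_eq ?_)
          rw [div_eq_mul_inv, ← Real.rpow_neg_one, ← Real.rpow_add hp0]
          push_cast
          ring_nf
      · refine (norm_warGauss_le_one _ _ _).trans ?_
        rw [Real.rpow_neg hp0.le, ← div_eq_mul_inv, one_le_div (by positivity)]
        have hη1 : η * h ≤ (2 * padicValNat p k + 2 : ℕ) := by
          have : (h : ℝ) ≤ (2 * padicValNat p k + 2 : ℕ) := by exact_mod_cast hh.le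
          nlinarith [Nat.cast_nonneg (α := ℝ) h]
        calc (p : ℝ) ^ (η * h) ≤ (p : ℝ) ^ (((2 * padicValNat p k + 2 : ℕ) : ℝ)) :=
              Real.rpow_le_rpow_of_exponent_le hp1 hη1
          _ = (p : ℝ) ^ (2 * padicValNat p k + 2) := Real.rpow_natCast _ _
          _ ≤ _ := pow_le_pow_left₀ hp0.le (by linarith) _

lemma abs_densityIncrement_prime_pow_le (k d N p h : ℕ) (hp : p.Prime) (hd : 2 ^ k + 1 ≤ d)
    (C : ℝ) (hC : ∀ a : ℕ, a.Coprime p →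
      ‖warGauss k (p ^ h) a‖ ≤ C * (p : ℝ) ^ (-(gaussExponent k * h))) :
    |densityIncrement k d N (p ^ h)| ≤ C ^ (2 ^ k + 1) *
      (p : ℝ) ^ (-((gaussExponent k * ((2 ^ k + 1 : ℕ) : ℝ) - 1) * h)) := by
  have hp0 : (0 : ℝ) < p := by exact_mod_cast hp.pos
  set D : ℕ := 2 ^ k + 1
  set η := gaussExponent k
  have hbound : ∀ a : ℕ, a.Coprime p → ‖warGauss k (p ^ h) a ^ d * e (-((N : ℝ) * a / (p ^ h : ℕ)))‖
      ≤ C ^ D * (p : ℝ) ^ (-(η * D * h)) := by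
    intro a ha
    rw [norm_mul, norm_e, mul_one, norm_pow]
    calc ‖warGauss k (p ^ h) a‖ ^ d ≤ ‖warGauss k (p ^ h) a‖ ^ D :=
          pow_le_pow_of_le_one (norm_nonneg _) (norm_warGauss_le_one _ _ _) hd
      _ ≤ (C * (p : ℝ) ^ (-(η * h))) ^ D := pow_le_pow_left₀ (norm_nonneg _) (hC a ha) D
      _ = C ^ D * (p : ℝ) ^ (-(η * D * h)) := by
          rw [mul_pow, ← Real.rpow_natCast ((p : ℝ) ^ (-(η * h))), ← Real.rpow_mul hp0.le]
          ring_nf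
  have hB : 0 ≤ C ^ D * (p : ℝ) ^ (-(η * D * h)) :=
    (norm_nonneg _).trans (hbound 1 (Nat.coprime_one_left p))
  have hcop : ∀ a ∈ (Icc 1 (p ^ h)).filter (fun a => Nat.Coprime a (p ^ h)),
      ‖warGauss k (p ^ h) a ^ d * e (-((N : ℝ) * a / (p ^ h : ℕ)))‖
        ≤ C ^ D * (p : ℝ) ^ (-(η * D * h)) := by
    intro a ha
    rcases Nat.eq_zero_or_pos h with rfl | hh
    · have ha1 : a = 1 := by
        have := mem_Icc.1 (mem_filter.1 ha).1
        simp only [pow_zero] at this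
        omega
      exact hbound a (ha1 ▸ Nat.coprime_one_left p)
    · exact hbound a ((Nat.coprime_pow_right_iff hh _ _).1 (mem_filter.1 ha).2)
  rw [← Real.norm_eq_abs, ← Complex.norm_real, ← singularTerm_eq_densityIncrement, singularTerm]
  calc _ ≤ ∑ a ∈ (Icc 1 (p ^ h)).filter (fun a => Nat.Coprime a (p ^ h)),
        C ^ D * (p : ℝ) ^ (-(η * D * h)) := norm_sum_le_of_le _ hcop
    _ ≤ (p ^ h : ℕ) * (C ^ D * (p : ℝ) ^ (-(η * D * h))) := by
        rw [sum_const, nsmul_eq_mul]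
        refine mul_le_mul_of_nonneg_right (Nat.cast_le.2 ?_) hB
        exact (card_filter_le _ _).trans (by simp)
    _ = C ^ D * (p : ℝ) ^ (-((η * (D : ℝ) - 1) * h)) := by
        rw [show -((η * (D : ℝ) - 1) * h) = (h : ℝ) + -(η * D * h) by ring, Real.rpow_add hp0,
          Real.rpow_natCast]
        push_cast
        ring

/-- A bound for a multiplicative function follows from bounds on prime powers. -/
lemma abs_le_of_prime_pow_le (f : ArithmeticFunction ℝ) (hf : f.IsMultiplicative) (P : ℕ)
    (K : ℕ → ℝ) (σ : ℝ) (hK : ∀ p, 1 ≤ K p) (hKP : ∀ p, P ≤ p → K p = 1)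
    (hb : ∀ p : ℕ, p.Prime → ∀ h : ℕ, |f (p ^ h)| ≤ K p * (p : ℝ) ^ (-(σ * h))) (n : ℕ)
    (hn : n ≠ 0) : |f n| ≤ (∏ p ∈ range P, K p) * (n : ℝ) ^ (-σ) := by
  rw [hf.multiplicative_factorization f hn, Finsupp.prod, abs_prod]
  have hfac : (n : ℝ) ^ (-σ) = ∏ p ∈ n.factorization.support,
      (p : ℝ) ^ (-(σ * n.factorization p)) := by
    conv_lhs => rw [← Nat.prod_factorization_pow_eq_self hn]
    rw [Finsupp.prod, Nat.cast_prod, ← Real.finsetProd_rpow _ _ (fun _ _ => by positivity)]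
    refine prod_congr rfl fun p _ => ?_
    rw [Nat.cast_pow, ← Real.rpow_natCast, ← Real.rpow_mul (Nat.cast_nonneg p)]
    ring_nf
  calc ∏ p ∈ n.factorization.support, |f (p ^ n.factorization p)|
      ≤ ∏ p ∈ n.factorization.support, K p * (p : ℝ) ^ (-(σ * n.factorization p)) :=
        prod_le_prod (fun _ _ => abs_nonneg _) fun p hp =>
          hb p (Nat.prime_of_mem_primeFactors (by simpa using hp)) _
    _ = (∏ p ∈ n.factorization.support, K p) * (n : ℝ) ^ (-σ) := by
        rw [prod_mul_distrib, hfac]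
    _ ≤ (∏ p ∈ range P, K p) * (n : ℝ) ^ (-σ) := by
        refine mul_le_mul_of_nonneg_right ?_ (by positivity)
        rw [← prod_filter_mul_prod_filter_not _ (fun p => p < P),
          prod_eq_one (s := filter (fun p => ¬ p < P) _)
            (fun p hp => hKP p (not_lt.1 (mem_filter.1 hp).2)), mul_one]
        exact prod_le_prod_of_subset_of_one_le
          (fun p hp => mem_range.2 (mem_filter.1 hp).2)
          (fun p _ => zero_le_one.trans (hK p)) (fun p _ _ => hK p)

lemma summable_norm_of_prime_pow_le (f : ArithmeticFunction ℝ) (hf : f.IsMultiplicative) (P : ℕ)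
    (K : ℕ → ℝ) (σ : ℝ) (hσ : 1 < σ) (hK : ∀ p, 1 ≤ K p) (hKP : ∀ p, P ≤ p → K p = 1)
    (hb : ∀ p : ℕ, p.Prime → ∀ h : ℕ, |f (p ^ h)| ≤ K p * (p : ℝ) ^ (-(σ * h))) :
    Summable fun n => ‖f n‖ := by
  refine Summable.of_nonneg_of_le (fun _ => norm_nonneg _) (fun n => ?_)
    ((Real.summable_nat_rpow.2 (by linarith : -σ < -1)).mul_left (∏ p ∈ range P, K p))
  rcases Nat.eq_zero_or_pos n with rfl | hn
  · rw [f.map_zero, norm_zero]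
    have : 0 ≤ ∏ p ∈ range P, K p := prod_nonneg fun p _ => zero_le_one.trans (hK p)
    positivity
  · exact abs_le_of_prime_pow_le f hf P K σ hK hKP hb n hn.ne'

lemma one_sub_sum_le_prod (t : Finset ℕ) (x ε : ℕ → ℝ) (hε : ∀ p ∈ t, 0 ≤ ε p)
    (hx : ∀ p ∈ t, 1 - ε p ≤ x p) (hsum : ∑ p ∈ t, ε p ≤ 1) :
    1 - ∑ p ∈ t, ε p ≤ ∏ p ∈ t, x p := by
  induction t using Finset.induction_on with
  | empty => simp
  | insert p t hpt ih =>
    rw [sum_insert hpt] at hsum ⊢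
    rw [prod_insert hpt]
    have hε0 := hε p (mem_insert_self p t)
    have hs0 : 0 ≤ ∑ i ∈ t, ε i := sum_nonneg fun i hi => hε i (mem_insert_of_mem hi)
    have ih' := ih (fun i hi => hε i (mem_insert_of_mem hi))
      (fun i hi => hx i (mem_insert_of_mem hi)) (by linarith)
    have hxp := hx p (mem_insert_self p t)
    calc 1 - (ε p + ∑ i ∈ t, ε i) ≤ (1 - ε p) * (1 - ∑ i ∈ t, ε i) := by nlinarith
      _ ≤ x p * ∏ i ∈ t, x i := by
          refine mul_le_mul hxp ih' (by linarith) (by linarith)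

lemma one_sub_le_tsum_prime_pow (f : ArithmeticFunction ℝ) (hf : f.IsMultiplicative) (p : ℕ)
    (hp : p.Prime) (σ : ℝ) (hσ : 1 < σ)
    (hb : ∀ h : ℕ, |f (p ^ h)| ≤ (p : ℝ) ^ (-(σ * h))) :
    1 - 2 * (p : ℝ) ^ (-σ) ≤ ∑' h, f (p ^ h) := by
  have hp2 : (2 : ℝ) ≤ p := by exact_mod_cast hp.two_le
  have hp0 : (0 : ℝ) < p := by linarith
  set x := (p : ℝ) ^ (-σ) with hx
  have hx0 : 0 < x := by positivity
  have hx2 : x ≤ 1 / 2 := by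
    calc x ≤ (p : ℝ) ^ (-1 : ℝ) := Real.rpow_le_rpow_of_exponent_le (by linarith) (by linarith)
      _ = (p : ℝ)⁻¹ := Real.rpow_neg_one _
      _ ≤ 1 / 2 := by
          rw [one_div]
          exact inv_anti₀ (by norm_num) hp2
  have hb' : ∀ h : ℕ, |f (p ^ h)| ≤ x ^ h := by
    intro h
    rw [hx, ← Real.rpow_natCast, ← Real.rpow_mul hp0.le]
    simpa using hb h
  have hgeom : Summable fun h : ℕ => x ^ h := summable_geometric_of_lt_one hx0.le (by linarith)
  have hsum : Summable fun h : ℕ => f (p ^ h) := Summable.of_norm_bounded hgeom hb'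
  have hgeom' : Summable fun h : ℕ => x * x ^ h := hgeom.mul_left x
  have htail : -(x * (1 - x)⁻¹) ≤ ∑' h, f (p ^ (h + 1)) := by
    rw [← tsum_geometric_of_lt_one hx0.le (by linarith), ← tsum_mul_left, ← tsum_neg]
    refine hgeom'.neg.tsum_le_tsum (fun h => ?_) ((summable_nat_add_iff 1).2 hsum)
    have := (abs_le.1 (hb' (h + 1))).1
    rw [pow_succ'] at this
    exact this
  rw [hsum.tsum_eq_zero_add, pow_zero, hf.map_one]
  have : x * (1 - x)⁻¹ ≤ 2 * x := by
    rw [mul_comm 2]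
    refine mul_le_mul_of_nonneg_left ?_ hx0.le
    rw [inv_le_comm₀ (by linarith) (by norm_num)]
    linarith
  linarith

/-- Lower bound for an Euler product whose factors are explicitly bounded below at small primes
and close to `1` at large primes. -/
lemma exists_half_prod_le_tsum (P : ℕ) (σ : ℝ) (hσ : 1 < σ) :
    ∃ R : ℕ, ∀ (K B : ℕ → ℝ) (f : ArithmeticFunction ℝ), f.IsMultiplicative →
      (∀ p, 1 ≤ K p) → (∀ p, P ≤ p → K p = 1) → (∀ p, 0 ≤ B p) →
      (∀ p : ℕ, p.Prime → ∀ h : ℕ, |f (p ^ h)| ≤ K p * (p : ℝ) ^ (-(σ * h))) →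
      (∀ p : ℕ, p.Prime → B p ≤ ∑' h, f (p ^ h)) →
      1 / 2 * ∏ p ∈ Nat.primesBelow R, B p ≤ ∑' n, f n := by
  have hs : Summable fun n : ℕ => 2 * (n : ℝ) ^ (-σ) :=
    (Real.summable_nat_rpow.2 (by linarith : -σ < -1)).mul_left 2
  obtain ⟨s, hs⟩ := summable_iff_vanishing_norm.1 hs (1 / 2) (by norm_num)
  obtain ⟨R₀, hR₀⟩ := s.exists_nat_subset_range
  refine ⟨max P R₀, fun K B f hf hK hKP hB hb hBf => ?_⟩
  have hEuler := hf.eulerProduct (summable_norm_of_prime_pow_le f hf P K σ hσ hK hKP hb)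
  refine ge_of_tendsto hEuler ?_
  filter_upwards [Filter.eventually_ge_atTop (max P R₀)] with n hn
  have hsub : Nat.primesBelow (max P R₀) ⊆ n.primesBelow := by
    intro p hp
    rw [Nat.mem_primesBelow] at hp ⊢
    exact ⟨hp.1.trans_le hn, hp.2⟩
  rw [← prod_sdiff hsub]
  set t := n.primesBelow \ Nat.primesBelow (max P R₀) with ht
  have htp : ∀ p ∈ t, p.Prime ∧ max P R₀ ≤ p := by
    intro p hp
    rw [ht, mem_sdiff, Nat.mem_primesBelow, Nat.mem_primesBelow] at hp
    refine ⟨hp.1.2, ?_⟩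
    by_contra hlt
    exact hp.2 ⟨not_le.1 hlt, hp.1.2⟩
  have htail : ∑ p ∈ t, 2 * (p : ℝ) ^ (-σ) ≤ 1 / 2 := by
    refine (le_abs_self _).trans (hs t ?_).le
    rw [disjoint_left]
    intro p hp hps
    have := mem_range.1 (hR₀ hps)
    have := le_of_max_le_right (htp p hp).2
    omega
  have hlarge : 1 / 2 ≤ ∏ p ∈ t, ∑' h, f (p ^ h) := by
    refine le_trans (by linarith) (one_sub_sum_le_prod t _ (fun p => 2 * (p : ℝ) ^ (-σ))
      (fun p _ => by positivity) (fun p hp => ?_) (by linarith))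
    refine one_sub_le_tsum_prime_pow f hf p (htp p hp).1 σ hσ fun h => ?_
    simpa [hKP p (le_of_max_le_left (htp p hp).2)] using hb p (htp p hp).1 h
  refine mul_le_mul hlarge (prod_le_prod (fun p _ => hB p) fun p hp => ?_)
    (prod_nonneg fun p _ => hB p) (by linarith)
  exact hBf p (Nat.prime_of_mem_primesBelow hp)

lemma cube_le_two_pow (k : ℕ) (hk : 10 ≤ k) : k ^ 3 ≤ 2 ^ k := by
  induction k, hk using Nat.le_induction with
  | base => norm_num
  | succ n hn ih =>
    rw [pow_succ 2]
    nlinarith [Nat.mul_le_mul hn hn]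

lemma sq_mul_le_or_exceptional (k q p : ℕ) (hk : 2 ≤ k) (hqk : q ∣ k) (hpq : p ∣ q)
    (hp : p.Prime) :
    q ^ 2 * p ≤ 2 ^ k + 1 ∨ (k = 2 ∧ q ^ 2 * p = 8) ∨ (k = 3 ∧ q ^ 2 * p = 27) ∨
      (k = 4 ∧ q ^ 2 * p = 32) ∨ (k = 5 ∧ q ^ 2 * p = 125) ∨ (k = 6 ∧ q ^ 2 * p ≤ 128) ∨
      (k = 7 ∧ q ^ 2 * p = 343) := by
  have hqle : q ≤ k := Nat.le_of_dvd (by omega) hqk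
  have hq0 : 0 < q := Nat.pos_of_dvd_of_pos hqk (by omega)
  have hple : p ≤ q := Nat.le_of_dvd hq0 hpq
  rcases le_or_gt 10 k with hlarge | hsmall
  · left
    calc q ^ 2 * p ≤ k ^ 2 * k := Nat.mul_le_mul (Nat.pow_le_pow_left hqle 2) (hple.trans hqle)
      _ = k ^ 3 := by ring
      _ ≤ 2 ^ k + 1 := (cube_le_two_pow k hlarge).trans (Nat.le_succ _)
  · have hp2 := hp.two_le
    interval_cases k <;> interval_cases q <;> first | omega | skip
    all_goals interval_cases p <;> first | omega | (exfalso; revert hp; norm_num)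

/-- Every residue class is a sum of ones, at least one of them, and of copies of a single
`k`-th power. -/
lemma exists_add_mul_pow_modEq (k q p N : ℕ) (hk : 2 ≤ k) (hqk : q ∣ k) (hpq : p ∣ q)
    (hp : p.Prime) :
    ∃ x a b : ℕ, 1 ≤ a ∧ a + b ≤ 2 ^ k + 1 ∧ a + b * x ^ k ≡ N [MOD q ^ 2 * p] := by
  have hcases := sq_mul_le_or_exceptional k q p hk hqk hpq hp
  have hM : 0 < q ^ 2 * p := by
    have : 0 < q := Nat.pos_of_dvd_of_pos hqk (by omega)
    have := hp.pos
    positivity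
  generalize q ^ 2 * p = M at hcases hM
  obtain ⟨r, hr1, hrM, hrN⟩ : ∃ r, 1 ≤ r ∧ r ≤ M ∧ r ≡ N [MOD M] := by
    rcases Nat.eq_zero_or_pos (N % M) with h0 | hpos
    · exact ⟨M, hM, le_rfl, by simp [Nat.ModEq, h0]⟩
    · exact ⟨N % M, hpos, (Nat.mod_lt N hM).le, Nat.mod_modEq N M⟩
  suffices h : ∃ x a b : ℕ, 1 ≤ a ∧ a + b ≤ 2 ^ k + 1 ∧ a + b * x ^ k ≡ r [MOD M] by
    obtain ⟨x, a, b, h1, h2, h3⟩ := h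
    exact ⟨x, a, b, h1, h2, h3.trans hrN⟩
  by_cases hle : r ≤ 2 ^ k + 1
  · exact ⟨0, r, 0, hr1, hle, by simp [Nat.ModEq]⟩
  unfold Nat.ModEq
  rcases hcases with h | ⟨rfl, rfl⟩ | ⟨rfl, rfl⟩ | ⟨rfl, rfl⟩ | ⟨rfl, rfl⟩ | ⟨rfl, h⟩ | ⟨rfl, rfl⟩
  · omega
  · exact ⟨2, r - 4, 1, by omega, by omega, by omega⟩
  · by_cases h1 : r ≤ 16
    · exact ⟨2, r - 8, 1, by omega, by omega, by omega⟩
    by_cases h2 : r ≤ 23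
    · exact ⟨2, r - 16, 2, by omega, by omega, by omega⟩
    by_cases h3 : r = 24
    · exact ⟨2, 3, 6, by omega, by omega, by omega⟩
    · exact ⟨2, r - 24, 3, by omega, by omega, by omega⟩
  · exact ⟨3, r - 17, 1, by omega, by omega, by omega⟩
  · exact ⟨3, r + 7 * ((132 - r) / 7) - 125, (132 - r) / 7, by omega, by omega, by omega⟩
  · refine ⟨2, r - 64, 1, by omega, by omega, ?_⟩
    rw [show r - 64 + 1 * 2 ^ 6 = r by omega]
  · by_cases h1 : r ≤ 256
    · exact ⟨2, r - 128, 1, by omega, by omega, by omega⟩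
    · exact ⟨2, r - 256, 2, by omega, by omega, by omega⟩

lemma exists_sum_pow_eq_of_le {s m : ℕ} (hsm : s ≤ m) {k : ℕ} (hk : k ≠ 0) (y : ℕ → ℕ) :
    ∃ y' : ℕ → ℕ, ∑ i ∈ range m, y' i ^ k = ∑ i ∈ range s, y i ^ k := by
  refine ⟨fun i => if i < s then y i else 0, ?_⟩
  obtain ⟨t, rfl⟩ := Nat.exists_eq_add_of_le hsm
  rw [sum_range_add]
  simp only [ite_pow, zero_pow hk]
  rw [sum_congr rfl (fun i hi => if_pos (mem_range.1 hi))]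
  simp

open scoped Pointwise in
/-- Every residue class modulo a prime is a sum of `k` many `k`-th powers. -/
lemma exists_sum_pow_eq_zmod_prime (p k : ℕ) [Fact p.Prime] (hk : 0 < k) (c : ZMod p) :
    ∃ y : ℕ → ℕ, ∑ i ∈ range k, ((y i : ZMod p)) ^ k = c := by
  classical
  have hp : p.Prime := Fact.out
  set A : Finset (ZMod p) := univ.image fun x : ZMod p => x ^ k with hA
  have hA0 : (0 : ZMod p) ∈ A := mem_image.2 ⟨0, mem_univ _, zero_pow hk.ne'⟩
  have hAcard : p - 1 ≤ k * (#A - 1) := by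
    have h1 : #(univ.erase (0 : ZMod p)) = p - 1 := by
      rw [card_erase_of_mem (mem_univ _), card_univ, ZMod.card]
    have h2 : (univ.erase (0 : ZMod p)).image (fun x => x ^ k) ⊆ A.erase 0 := by
      intro z hz
      obtain ⟨x, hx, rfl⟩ := mem_image.1 hz
      exact mem_erase.2 ⟨pow_ne_zero k (mem_erase.1 hx).1, mem_image.2 ⟨x, mem_univ _, rfl⟩⟩
    rw [← h1, ← card_erase_of_mem hA0]
    refine (card_le_mul_card_image _ k fun b _ => ?_).trans
      (Nat.mul_le_mul_left k (card_le_card h2))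
    exact (card_le_card (filter_subset_filter _ (subset_univ _))).trans (card_pow_eq_le k hk b)
  set T : ℕ → Finset (ZMod p) := fun s =>
    univ.filter fun c => ∃ y : ℕ → ℕ, ∑ i ∈ range s, ((y i : ZMod p)) ^ k = c with hT
  have hT0 : ∀ s, (0 : ZMod p) ∈ T s := by
    intro s
    simp only [hT, mem_filter, mem_univ, true_and]
    exact ⟨fun _ => 0, by simp [hk.ne']⟩
  have hstep : ∀ s, T s + A ⊆ T (s + 1) := by
    intro s z hz
    obtain ⟨u, hu, v, hv, rfl⟩ := mem_add.1 hz
    obtain ⟨y, hy⟩ := (mem_filter.1 hu).2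
    obtain ⟨x, _, rfl⟩ := mem_image.1 hv
    simp only [hT, mem_filter, mem_univ, true_and]
    refine ⟨fun i => if i < s then y i else x.val, ?_⟩
    rw [sum_range_succ, ← hy]
    congr 1
    · exact sum_congr rfl fun i hi => by simp [mem_range.1 hi]
    · simp
  have hcard : ∀ s, min p (s * (#A - 1) + 1) ≤ #(T s) := by
    intro s
    induction s with
    | zero =>
      have : 0 < #(T 0) := card_pos.2 ⟨0, hT0 0⟩
      omega
    | succ s ih =>
      have h1 := ZMod.cauchy_davenport hp ⟨0, hT0 s⟩ ⟨0, hA0⟩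
      have h2 := card_le_card (hstep s)
      have h3 : 0 < #A := card_pos.2 ⟨0, hA0⟩
      rw [Nat.succ_mul]
      omega
  have huniv : T k = univ := by
    refine eq_univ_of_card _ (le_antisymm (card_le_univ _) ?_)
    have := hcard k
    have := hp.pos
    rw [ZMod.card]
    omega
  exact (mem_filter.1 (huniv ▸ mem_univ c : c ∈ T k)).2

/-- Primitive solubility of Waring's equation modulo the power of `p` required by Hensel's lemma:
one of the variables can be taken equal to `1`. -/
lemma exists_one_add_sum_pow_modEq (p k N m : ℕ) [Fact p.Prime] (hk : 2 ≤ k) (hm : 2 ^ k ≤ m) :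
    ∃ y : ℕ → ℕ, 1 + ∑ i ∈ range m, y i ^ k ≡ N [MOD p ^ (2 * padicValNat p k + 1)] := by
  have hp : p.Prime := Fact.out
  by_cases hpk : p ∣ k
  · have hτ : padicValNat p k ≠ 0 := by
      have := one_le_padicValNat_of_dvd (by omega) hpk
      omega
    obtain ⟨x, a, b, ha, hab, hN⟩ := exists_add_mul_pow_modEq k (p ^ padicValNat p k) p N hk
      pow_padicValNat_dvd (dvd_pow_self p hτ) hp
    obtain ⟨a, rfl⟩ : ∃ a', a = a' + 1 := ⟨a - 1, by omega⟩
    obtain ⟨y, hy⟩ := exists_sum_pow_eq_of_le (s := a + b) (m := m) (by omega) (k := k) (by omega)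
      (fun i => if i < a then 1 else x)
    refine ⟨y, ?_⟩
    have hsum : ∑ i ∈ range (a + b), (if i < a then 1 else x) ^ k = a + b * x ^ k := by
      rw [sum_range_add, sum_congr rfl (fun i hi => by rw [if_pos (mem_range.1 hi)])]
      simp
    rw [hy, hsum, show 1 + (a + b * x ^ k) = a + 1 + b * x ^ k by ring, pow_succ,
      mul_comm 2 (padicValNat p k), pow_mul]
    exact hN
  · obtain ⟨y, hy⟩ := exists_sum_pow_eq_zmod_prime p k (by omega) ((N : ZMod p) - 1)
    obtain ⟨y', hy'⟩ := exists_sum_pow_eq_of_le (s := k) (m := m)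
      (Nat.lt_two_pow_self.le.trans hm) (k := k) (by omega) y
    refine ⟨y', ?_⟩
    rw [padicValNat.eq_zero_of_not_dvd hpk, mul_zero, zero_add, pow_one,
      ← ZMod.natCast_eq_natCast_iff, hy']
    push_cast
    rw [hy]
    ring

/-- Integers sufficiently close to `1` in the `p`-adic metric are `k`-th powers modulo every power
of `p`. -/
lemma exists_pow_eq_zmod_prime_pow (p k : ℕ) [Fact p.Prime] (hk : k ≠ 0) (m : ℤ)
    (hm : (p : ℤ) ^ (2 * padicValNat p k + 1) ∣ 1 - m) (h : ℕ) :
    ∃ x : ZMod (p ^ h), x ^ k = (m : ZMod (p ^ h)) := by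
  have hp : p.Prime := Fact.out
  have hp1 : (1 : ℝ) < p := by exact_mod_cast hp.one_lt
  set τ := padicValNat p k with hτ
  have hnormk : ‖(k : ℤ_[p])‖ = (p : ℝ) ^ (-τ : ℤ) := by
    obtain ⟨c, hc⟩ : p ^ τ ∣ k := pow_padicValNat_dvd
    have hcop : p.Coprime c := by
      rw [hp.coprime_iff_not_dvd]
      intro hdvd
      apply pow_succ_padicValNat_not_dvd (p := p) hk
      rw [pow_succ, ← hτ]
      conv_rhs => rw [hc]
      exact Nat.mul_dvd_mul_left _ hdvd
    have hcast : (k : ℤ_[p]) = (p : ℤ_[p]) ^ τ * c := by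
      rw [hc]
      push_cast
      ring
    rw [hcast, norm_mul, PadicInt.norm_p_pow, PadicInt.norm_natCast_eq_one_iff.2 hcop, mul_one]
  have hnormm : ‖((1 - m : ℤ) : ℤ_[p])‖ ≤ (p : ℝ) ^ (-(2 * τ + 1 : ℕ) : ℤ) :=
    PadicInt.norm_int_le_pow_iff_dvd.2 (by exact_mod_cast hm)
  obtain ⟨z, hz, -⟩ := hensels_lemma (p := p) (R := ℤ)
    (F := Polynomial.X ^ k - Polynomial.C m) (a := 1) (by
      have hF : Polynomial.aeval (1 : ℤ_[p]) (Polynomial.X ^ k - Polynomial.C m : Polynomial ℤ)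
          = ((1 - m : ℤ) : ℤ_[p]) := by simp
      have hF' : Polynomial.aeval (1 : ℤ_[p])
          (Polynomial.X ^ k - Polynomial.C m : Polynomial ℤ).derivative = (k : ℤ_[p]) := by
        simp [Polynomial.derivative_X_pow]
      rw [hF, hF', hnormk]
      refine hnormm.trans_lt ?_
      rw [← zpow_natCast, ← zpow_mul]
      refine zpow_lt_zpow_right₀ hp1 ?_
      push_cast
      linarith)
  refine ⟨PadicInt.toZModPow h z, ?_⟩
  have hzm : z ^ k = (m : ℤ_[p]) := by simpa [sub_eq_zero] using hz
  rw [← map_pow, hzm, map_intCast]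

lemma pow_le_solutionCount_prime_pow (p k n N h : ℕ) [Fact p.Prime] (hk : 2 ≤ k)
    (hn : 2 ^ k ≤ n) :
    (p ^ h) ^ n ≤ solutionCount k (n + 1) N (p ^ (2 * padicValNat p k + 1 + h)) := by
  have hp : p.Prime := Fact.out
  obtain ⟨y, hy⟩ := exists_one_add_sum_pow_modEq p k N n hk hn
  set γ := 2 * padicValNat p k + 1 with hγ
  have hroot : ∀ z : Fin n → Fin (p ^ h), ∃ x : ZMod (p ^ (γ + h)),
      x ^ k = (((N : ℤ) - ∑ i : Fin n, ((y i + p ^ γ * z i : ℕ) : ℤ) ^ k : ℤ) :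
        ZMod (p ^ (γ + h))) := by
    intro z
    refine exists_pow_eq_zmod_prime_pow p k (by omega) _ ?_ _
    have hcongr : 1 + ∑ i : Fin n, (y i + p ^ γ * z i) ^ k ≡ N [MOD p ^ γ] := by
      refine Nat.ModEq.trans ?_ hy
      rw [← Fin.sum_univ_eq_sum_range (fun i => y i ^ k) n, ← ZMod.natCast_eq_natCast_iff]
      simp
    have := (Nat.modEq_iff_dvd.1 hcongr.symm)
    push_cast at this ⊢
    convert this using 1
    ring
  choose x hx using hroot
  have hq : NeZero (p ^ (γ + h)) := ⟨(pow_pos hp.pos _).ne'⟩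
  let φ : (Fin n → Fin (p ^ h)) →
      {x : Fin (n + 1) → ZMod (p ^ (γ + h)) // ∑ i, x i ^ k = (N : ZMod (p ^ (γ + h)))} :=
    fun z => ⟨Fin.cons (x z) fun i => ((y i + p ^ γ * z i : ℕ) : ZMod (p ^ (γ + h))), by
      rw [Fin.sum_univ_succ]
      simp only [Fin.cons_zero, Fin.cons_succ, hx]
      push_cast
      ring⟩
  have hφ : Function.Injective φ := by
    intro z w hzw
    funext i
    have hi := congrFun (congrArg Subtype.val hzw) i.succ
    simp only [φ, Fin.cons_succ] at hi
    rw [ZMod.natCast_eq_natCast_iff] at hi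
    have hi' := Nat.ModEq.add_left_cancel' _ hi
    rw [pow_add] at hi'
    have := Nat.ModEq.mul_left_cancel' (pow_pos hp.pos γ).ne' hi'
    exact Fin.ext (Nat.ModEq.eq_of_lt_of_lt this (z i).2 (w i).2)
  have := Nat.card_le_card_of_injective φ hφ
  simpa [solutionCount] using this

lemma inv_pow_le_localDensity_prime_pow (p k d N h : ℕ) (hp : p.Prime) (hk : 2 ≤ k)
    (hd : 2 ^ k + 1 ≤ d) (hh : 2 * padicValNat p k + 1 ≤ h) :
    (((p : ℝ) ^ (2 * padicValNat p k + 1))⁻¹) ^ d ≤ localDensity k d N (p ^ h) := by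
  have : Fact p.Prime := ⟨hp⟩
  obtain ⟨n, rfl⟩ : ∃ n, d = n + 1 := ⟨d - 1, (Nat.sub_add_cancel (le_of_add_le_right hd)).symm⟩
  obtain ⟨j, rfl⟩ := Nat.exists_eq_add_of_le hh
  have hcount := pow_le_solutionCount_prime_pow p k n N j hk (Nat.le_of_succ_le_succ hd)
  set γ := 2 * padicValNat p k + 1
  have hp0 : (0 : ℝ) < p := by exact_mod_cast hp.pos
  have hp1 : (1 : ℝ) ≤ p := by exact_mod_cast hp.one_le
  have hcount' : ((p : ℝ) ^ j) ^ n ≤ solutionCount k (n + 1) N (p ^ (γ + j)) := by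
    exact_mod_cast hcount
  calc (((p : ℝ) ^ γ)⁻¹) ^ (n + 1) ≤ (((p : ℝ) ^ γ)⁻¹) ^ n :=
        pow_le_pow_of_le_one (by positivity) (inv_le_one_of_one_le₀ (one_le_pow₀ hp1))
          (Nat.le_succ n)
    _ = ((p : ℝ) ^ j) ^ n * (p : ℝ) ^ (γ + j) / ((p : ℝ) ^ (γ + j)) ^ (n + 1) := by
        rw [pow_succ ((p : ℝ) ^ (γ + j)), mul_div_mul_right _ _ (by positivity), pow_add _ γ j, mul_pow,
          inv_pow]
        field_simp
    _ ≤ solutionCount k (n + 1) N (p ^ (γ + j)) * (p : ℝ) ^ (γ + j)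
          / ((p : ℝ) ^ (γ + j)) ^ (n + 1) := by gcongr
    _ = localDensity k (n + 1) N (p ^ (γ + j)) := by simp [localDensity]

lemma inv_pow_le_tsum_densityIncrement (p k d N : ℕ) (hp : p.Prime) (hk : 2 ≤ k)
    (hd : 2 ^ k + 1 ≤ d) (hs : Summable fun h => densityIncrement k d N (p ^ h)) :
    (((p : ℝ) ^ (2 * padicValNat p k + 1))⁻¹) ^ d ≤ ∑' h, densityIncrement k d N (p ^ h) := by
  have hlim := (Filter.tendsto_add_atTop_iff_nat 1).2 hs.hasSum.tendsto_sum_nat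
  refine ge_of_tendsto hlim ?_
  filter_upwards [Filter.eventually_ge_atTop (2 * padicValNat p k + 1)] with h hh
  rw [sum_range_densityIncrement_prime_pow k d N p h hp]
  exact inv_pow_le_localDensity_prime_pow p k d N h hp hk hd hh

theorem singular_series_lower_bound (k : ℕ) (hk : 2 ≤ k) :
    ∃ a : ℝ, 0 < a ∧ ∀ d : ℕ, 2 ^ k + 1 ≤ d → ∀ N : ℕ, 1 ≤ N →
      ∃ s : ℝ, singularSeries k d N = (s : ℂ) ∧ a ^ d ≤ s := by
  obtain ⟨P, C, hC1, hCP, hC⟩ := exists_norm_warGauss_prime_pow_le k hk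
  have hσ : 1 < gaussExponent k * ((2 ^ k + 1 : ℕ) : ℝ) - 1 := by
    linarith [two_lt_gaussExponent_mul k hk]
  obtain ⟨R, hR⟩ := exists_half_prod_le_tsum P _ hσ
  refine ⟨1 / 2 * ∏ p ∈ Nat.primesBelow R, ((p : ℝ) ^ (2 * padicValNat p k + 1))⁻¹, ?_, ?_⟩
  · refine mul_pos (by norm_num) (prod_pos fun p hp => ?_)
    have : (0 : ℝ) < p := by exact_mod_cast (Nat.prime_of_mem_primesBelow hp).pos
    positivity
  intro d hd N _
  have hbound : ∀ p : ℕ, p.Prime → ∀ h : ℕ, |densityIncrement k d N (p ^ h)|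
      ≤ C p ^ (2 ^ k + 1) * (p : ℝ) ^ (-((gaussExponent k * ((2 ^ k + 1 : ℕ) : ℝ) - 1) * h)) :=
    fun p hp h => abs_densityIncrement_prime_pow_le k d N p h hp hd (C p) fun a ha => hC p hp h a ha
  have hK1 : ∀ p, 1 ≤ C p ^ (2 ^ k + 1) := fun p => one_le_pow₀ (hC1 p)
  have hKP : ∀ p, P ≤ p → C p ^ (2 ^ k + 1) = 1 := fun p hp => by rw [hCP p hp, one_pow]
  have hsum := summable_norm_of_prime_pow_le (densityIncrement k d N)
    (isMultiplicative_densityIncrement k d N) P _ _ hσ hK1 hKP hbound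
  refine ⟨∑' n, densityIncrement k d N n, ?_, ?_⟩
  · rw [Complex.ofReal_tsum]
    exact tsum_congr fun q => singularTerm_eq_densityIncrement k d N q
  · have hhalf := hR (fun p => C p ^ (2 ^ k + 1))
      (fun p => (((p : ℝ) ^ (2 * padicValNat p k + 1))⁻¹) ^ d) (densityIncrement k d N)
      (isMultiplicative_densityIncrement k d N) hK1 hKP (fun p => by positivity) hbound
      fun p hp => inv_pow_le_tsum_densityIncrement p k d N hp hk hd
        (hsum.of_norm.comp_injective (Nat.pow_right_injective hp.two_le))
    refine le_trans ?_ hhalf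
    rw [mul_pow, ← prod_pow]
    refine mul_le_mul_of_nonneg_right (pow_le_of_le_one (by norm_num) (by norm_num)
      (Nat.one_le_iff_ne_zero.1 (le_of_add_le_right hd)))
      (prod_nonneg fun p _ => by positivity)
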